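/- (Flow inequalities) For all i,t ∈ V with i ≠ t, both inequalities Σ_{j ∈ V∖{i}} y_{t,i,j} ≥ 1 and Σ_{j ∈ V∖{i}} y_{t,j,i} ≥ 1 are facet-defining for Ptt(n). -/

import Mathlib

open Finset

attribute [local instance] Classical.propDecidable

namespace TTP

/-- `(k,i,j)` is a valid match index: slot `k ∈ S = {1,…,2n-2}`, home venue `i` and
away team `j` are distinct elements of `V = {1,…,n}`. -/
def IsMatch (n : ℕ) (m : ℕ × ℕ × ℕ) : Prop :=
  1 ≤ m.1 ∧ m.1 ≤ 2 * n - 2 ∧ 1 ≤ m.2.1 ∧ m.2.1 ≤ n ∧ 1 ≤ m.2.2 ∧ m.2.2 ≤ n ∧ m.2.1 ≠ m.2.2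

/-- `(t,i,j)` is a valid travel index: `t ∈ V` and `(i,j) ∈ A`. -/
def IsTravelIdx (n : ℕ) (p : ℕ × ℕ × ℕ) : Prop :=
  1 ≤ p.1 ∧ p.1 ≤ n ∧ 1 ≤ p.2.1 ∧ p.2.1 ≤ n ∧ 1 ≤ p.2.2 ∧ p.2.2 ≤ n ∧ p.2.1 ≠ p.2.2

/-- A (double round-robin) tournament: a set of matches such that in every slot every team
plays exactly once, and every ordered pair of distinct teams meets exactly once. -/
structure IsTournament (n : ℕ) (T : Set (ℕ × ℕ × ℕ)) : Prop where
  subset : ∀ m ∈ T, IsMatch n m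
  slot_team : ∀ k, 1 ≤ k → k ≤ 2 * n - 2 → ∀ t, 1 ≤ t → t ≤ n →
      ∃! m : ℕ × ℕ × ℕ, m ∈ T ∧ m.1 = k ∧ (t = m.2.1 ∨ t = m.2.2)
  pair : ∀ i j, 1 ≤ i → i ≤ n → 1 ≤ j → j ≤ n → i ≠ j → ∃! k : ℕ, (k, i, j) ∈ T

/-- The venue of team `t` in slot `k`: the home venue of the (unique) match of `t` in
slot `k`, and `t` itself if `t` has no match in slot `k` (in particular in the artificial
slots `0` and `2n-1`). -/
noncomputable def venue (T : Set (ℕ × ℕ × ℕ)) (t k : ℕ) : ℕ :=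
  if h : ∃ i, ∃ j, (k, i, j) ∈ T ∧ (t = i ∨ t = j) then h.choose else t

/-- The travel vector `ψ(T)`: `travel n T (t,i,j) = 1` iff for some `0 ≤ k ≤ 2n-2` team `t`
has venue `i` in slot `k` and venue `j` in slot `k+1`. -/
noncomputable def travel (n : ℕ) (T : Set (ℕ × ℕ × ℕ)) (p : ℕ × ℕ × ℕ) : ℝ :=
  if ∃ k, k ≤ 2 * n - 2 ∧ venue T p.1 k = p.2.1 ∧ venue T p.1 (k + 1) = p.2.2 then 1 else 0

/-- The play vector `χ(T)`: characteristic vector of `T`. -/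
noncomputable def play (T : Set (ℕ × ℕ × ℕ)) (m : ℕ × ℕ × ℕ) : ℝ :=
  if m ∈ T then 1 else 0

/-- The ambient space `ℝ^M × ℝ^{V×A}`. -/
abbrev Pt (n : ℕ) :=
  ({m : ℕ × ℕ × ℕ // IsMatch n m} → ℝ) × ({p : ℕ × ℕ × ℕ // IsTravelIdx n p} → ℝ)

/-- The play coordinate `x_{k,i,j}` of a point (0 at invalid indices). -/
noncomputable def xval {n : ℕ} (z : Pt n) (k i j : ℕ) : ℝ :=
  if h : IsMatch n (k, i, j) then z.1 ⟨(k, i, j), h⟩ else 0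

/-- The travel coordinate `y_{t,i,j}` of a point (0 at invalid indices). -/
noncomputable def yval {n : ℕ} (z : Pt n) (t i j : ℕ) : ℝ :=
  if h : IsTravelIdx n (t, i, j) then z.2 ⟨(t, i, j), h⟩ else 0

/-- The unconstrained traveling tournament polytope `Ptt(n)`:
the convex hull of all pairs `(χ(T), y)` with `T` a tournament and `y ∈ {0,1}^{V×A}`,
`y ≥ ψ(T)` componentwise. -/
def Ptt (n : ℕ) : Set (Pt n) :=
  convexHull ℝ { z : Pt n | ∃ T : Set (ℕ × ℕ × ℕ), IsTournament n T ∧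
    (∀ m : {m : ℕ × ℕ × ℕ // IsMatch n m}, z.1 m = play T m.1) ∧
    (∀ p : {p : ℕ × ℕ × ℕ // IsTravelIdx n p}, z.2 p = 0 ∨ z.2 p = 1) ∧
    (∀ p : {p : ℕ × ℕ × ℕ // IsTravelIdx n p}, travel n T p.1 ≤ z.2 p) }

/-- Dimension of the affine hull of a set. -/
noncomputable def adim {n : ℕ} (s : Set (Pt n)) : ℕ :=
  Module.finrank ℝ (affineSpan ℝ s).direction

/-- A valid inequality `f z ≤ γ` is facet-defining for `Ptt(n)`:
it holds on `Ptt(n)` and its face has dimension `dim Ptt(n) - 1`. -/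
def IsFacetLE {n : ℕ} (f : Pt n → ℝ) (γ : ℝ) : Prop :=
  (∀ z ∈ Ptt n, f z ≤ γ) ∧ adim {z ∈ Ptt n | f z = γ} + 1 = adim (Ptt n)

/-- A valid inequality `f z ≥ γ` is facet-defining for `Ptt(n)`:
it holds on `Ptt(n)` and its face has dimension `dim Ptt(n) - 1`. -/
def IsFacetGE {n : ℕ} (f : Pt n → ℝ) (γ : ℝ) : Prop :=
  (∀ z ∈ Ptt n, γ ≤ f z) ∧ adim {z ∈ Ptt n | f z = γ} + 1 = adim (Ptt n)


/-- Teams `i` and `j` meet in round `k` of the circle-method round robin on `n` teams. -/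
def CircleMeets (n k i j : ℕ) : Prop :=
  (i < n ∧ j < n ∧ (i + j = k ∨ i + j = k + (n - 1))) ∨
  (i < n ∧ j = n ∧ (2 * i = k ∨ 2 * i = k + (n - 1))) ∨
  (i = n ∧ j < n ∧ (2 * j = k ∨ 2 * j = k + (n - 1)))

lemma CircleMeets.symm {n k i j : ℕ} (h : CircleMeets n k i j) : CircleMeets n k j i := by
  unfold CircleMeets at *; omega

lemma CircleMeets.right_unique {n k i j j' : ℕ} (heven : Even n) (hk : 1 ≤ k) (hkn : k ≤ n - 1)
    (hj : 1 ≤ j) (hj' : 1 ≤ j') (hij : i ≠ j) (hij' : i ≠ j')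
    (h : CircleMeets n k i j) (h' : CircleMeets n k i j') : j = j' := by
  obtain ⟨r, rfl⟩ := heven
  unfold CircleMeets at *; omega

lemma exists_circleMeets {n k i : ℕ} (heven : Even n) (hk : 1 ≤ k) (hkn : k ≤ n - 1)
    (hi : 1 ≤ i) (hin : i ≤ n) : ∃ j, 1 ≤ j ∧ j ≤ n ∧ i ≠ j ∧ CircleMeets n k i j := by
  obtain ⟨r, rfl⟩ := heven
  unfold CircleMeets
  by_cases h1 : i = r + r
  · rcases Nat.even_or_odd' k with ⟨c, hc | hc⟩
    · exact ⟨c, by omega⟩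
    · exact ⟨c + r, by omega⟩
  by_cases h2 : 2 * i = k ∨ 2 * i = k + (r + r - 1)
  · exact ⟨r + r, by omega⟩
  by_cases h3 : i < k
  · exact ⟨k - i, by omega⟩
  · exact ⟨k + (r + r - 1) - i, by omega⟩

lemma exists_round_circleMeets {n i j : ℕ} (hi : 1 ≤ i) (hin : i ≤ n) (hj : 1 ≤ j) (hjn : j ≤ n)
    (hij : i ≠ j) : ∃ k, 1 ≤ k ∧ k ≤ n - 1 ∧ CircleMeets n k i j := by
  unfold CircleMeets
  obtain ⟨s, hs⟩ : ∃ s, s = if i = n then 2 * j else if j = n then 2 * i else i + j := ⟨_, rfl⟩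
  by_cases h : s ≤ n - 1
  · exact ⟨s, by split_ifs at hs <;> omega⟩
  · exact ⟨s - (n - 1), by split_ifs at hs <;> omega⟩

lemma CircleMeets.round_unique {n k k' i j : ℕ} (hk : 1 ≤ k) (hkn : k ≤ n - 1)
    (hk' : 1 ≤ k') (hkn' : k' ≤ n - 1)
    (h : CircleMeets n k i j) (h' : CircleMeets n k' i j) : k = k' := by
  unfold CircleMeets at *; omega

/-- The mirrored double round robin built from the circle method. -/
def circleTournament (n : ℕ) : Set (ℕ × ℕ × ℕ) :=
  {m | IsMatch n m ∧ ((m.2.1 < m.2.2 ∧ m.1 ≤ n - 1 ∧ CircleMeets n m.1 m.2.1 m.2.2) ∨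
    (m.2.2 < m.2.1 ∧ n - 1 < m.1 ∧ CircleMeets n (m.1 - (n - 1)) m.2.1 m.2.2))}

lemma isTournament_circleTournament {n : ℕ} (heven : Even n) :
    IsTournament n (circleTournament n) where
  subset m hm := hm.1
  slot_team k hk hkn t ht htn := by
    apply existsUnique_of_exists_of_unique
    · by_cases h : k ≤ n - 1
      · obtain ⟨j, hj, hjn, hij, hm⟩ := exists_circleMeets heven hk h ht htn
        rcases lt_or_gt_of_ne hij with hlt | hlt
        · exact ⟨(k, t, j), ⟨⟨hk, hkn, ht, htn, hj, hjn, hij⟩, .inl ⟨hlt, h, hm⟩⟩, rfl, .inl rfl⟩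
        · exact ⟨(k, j, t), ⟨⟨hk, hkn, hj, hjn, ht, htn, hij.symm⟩, .inl ⟨hlt, h, hm.symm⟩⟩,
            rfl, .inr rfl⟩
      · obtain ⟨j, hj, hjn, hij, hm⟩ :=
          exists_circleMeets (k := k - (n - 1)) heven (by omega) (by omega) ht htn
        push Not at h
        rcases lt_or_gt_of_ne hij with hlt | hlt
        · exact ⟨(k, j, t), ⟨⟨hk, hkn, hj, hjn, ht, htn, hij.symm⟩, .inr ⟨hlt, h, hm.symm⟩⟩,
            rfl, .inr rfl⟩
        · exact ⟨(k, t, j), ⟨⟨hk, hkn, ht, htn, hj, hjn, hij⟩, .inr ⟨hlt, h, hm⟩⟩, rfl, .inl rfl⟩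
    · have key : ∀ {k i j i' j' : ℕ}, 1 ≤ k → k ≤ n - 1 → 1 ≤ i → 1 ≤ j → 1 ≤ i' → 1 ≤ j' →
          i ≠ j → i' ≠ j' → CircleMeets n k i j → CircleMeets n k i' j' →
          (t = i ∨ t = j) → (t = i' ∨ t = j') → (i = i' ∧ j = j') ∨ (i = j' ∧ j = i') := by
        intro k i j i' j' hk hkn hi hj hi' hj' hij hij' h h' ht ht'
        rcases ht with rfl | rfl <;> rcases ht' with rfl | rfl
        · exact .inl ⟨rfl, h.right_unique heven hk hkn hj hj' hij hij' h'⟩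
        · exact .inr ⟨rfl, h.right_unique heven hk hkn hj hi' hij hij'.symm h'.symm⟩
        · exact .inr ⟨h.symm.right_unique heven hk hkn hi hj' hij.symm hij' h', rfl⟩
        · exact .inl ⟨h.symm.right_unique heven hk hkn hi hi' hij.symm hij'.symm h'.symm, rfl⟩
      rintro ⟨a, i, j⟩ ⟨a', i', j'⟩ ⟨⟨⟨-, -, hi, -, hj, -, hij⟩, h⟩, rfl, ht⟩
        ⟨⟨⟨-, -, hi', -, hj', -, hij'⟩, h'⟩, haa, ht'⟩
      dsimp only at *
      subst haa
      rcases h with ⟨hlt, hle, h⟩ | ⟨hlt, hle, h⟩ <;>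
        rcases h' with ⟨hlt', hle', h'⟩ | ⟨hlt', hle', h'⟩
      · rcases key hk hle hi hj hi' hj' hij hij' h h' ht ht' with ⟨rfl, rfl⟩ | ⟨rfl, rfl⟩
        · rfl
        · omega
      · omega
      · omega
      · rcases key (by omega) (by omega) hi hj hi' hj' hij hij' h h' ht ht' with
          ⟨rfl, rfl⟩ | ⟨rfl, rfl⟩
        · rfl
        · omega
  pair i j hi hin hj hjn hij := by
    obtain ⟨k, hk, hkn, h⟩ := exists_round_circleMeets hi hin hj hjn hij
    rcases lt_or_gt_of_ne hij with hlt | hlt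
    · refine ⟨k, ⟨⟨hk, ?_, hi, hin, hj, hjn, hij⟩, .inl ⟨hlt, hkn, h⟩⟩, ?_⟩
      · show k ≤ 2 * n - 2
        omega
      · rintro k' ⟨⟨hk', -⟩, ⟨-, hle, h'⟩ | ⟨hlt', -⟩⟩
        · exact h'.round_unique hk' hle hk hkn h
        · exact absurd hlt hlt'.not_gt
    · refine ⟨k + (n - 1), ⟨⟨?_, ?_, hi, hin, hj, hjn, hij⟩, .inr ⟨hlt, ?_, ?_⟩⟩, ?_⟩
      · show 1 ≤ k + (n - 1)
        omega
      · show k + (n - 1) ≤ 2 * n - 2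
        omega
      · show n - 1 < k + (n - 1)
        omega
      · simpa using h
      · rintro k' ⟨⟨-, hkn', -⟩, ⟨hlt', -⟩ | ⟨-, hle, h'⟩⟩
        · exact absurd hlt hlt'.not_gt
        · dsimp only at *
          have := h'.round_unique (by omega) (by omega) hk hkn h
          omega

/-- Reorder the slots of a set of matches: slot `k` of the result is slot `σ k` of `T`. -/
def permSlots (σ : Equiv.Perm ℕ) (T : Set (ℕ × ℕ × ℕ)) : Set (ℕ × ℕ × ℕ) :=
  {m | (σ m.1, m.2.1, m.2.2) ∈ T}

lemma venue_permSlots (σ : Equiv.Perm ℕ) (T : Set (ℕ × ℕ × ℕ)) (t k : ℕ) :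
    venue (permSlots σ T) t k = venue T t (σ k) := rfl

lemma isTournament_permSlots_swap {n : ℕ} {T : Set (ℕ × ℕ × ℕ)} (hT : IsTournament n T) {a b : ℕ}
    (ha : 1 ≤ a ∧ a ≤ 2 * n - 2) (hb : 1 ≤ b ∧ b ≤ 2 * n - 2) :
    IsTournament n (permSlots (Equiv.swap a b) T) := by
  have hσ : ∀ k, (1 ≤ k ∧ k ≤ 2 * n - 2) →
      1 ≤ Equiv.swap a b k ∧ Equiv.swap a b k ≤ 2 * n - 2 := by
    intro k hk
    rw [Equiv.swap_apply_def]
    split_ifs <;> assumption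
  refine ⟨?_, ?_, ?_⟩
  · rintro ⟨k, i, j⟩ hm
    obtain ⟨h1, h2, h3⟩ := hT.subset _ hm
    have := hσ _ ⟨h1, h2⟩
    simp only [Equiv.swap_apply_self] at this
    exact ⟨this.1, this.2, h3⟩
  · intro k hk hkn t ht htn
    obtain ⟨⟨k', i, j⟩, ⟨hm, hk', hm'⟩, hu⟩ :=
      hT.slot_team _ (hσ k ⟨hk, hkn⟩).1 (hσ k ⟨hk, hkn⟩).2 t ht htn
    dsimp only at hk' hm'
    subst hk'
    refine ⟨(k, i, j), ⟨hm, rfl, hm'⟩, ?_⟩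
    rintro ⟨l, i', j'⟩ ⟨h1, rfl, h2⟩
    have := hu (Equiv.swap a b l, i', j') ⟨h1, rfl, h2⟩
    simp_all
  · intro i j hi hin hj hjn hij
    obtain ⟨k, hk, hu⟩ := hT.pair i j hi hin hj hjn hij
    refine ⟨Equiv.swap a b k, ?_, ?_⟩
    · show (Equiv.swap a b (Equiv.swap a b k), i, j) ∈ T
      rwa [Equiv.swap_apply_self]
    · intro l hl
      rw [← hu _ hl, Equiv.swap_apply_self]

section Venue

variable {n : ℕ} {T : Set (ℕ × ℕ × ℕ)}

lemma venue_eq_self_of_not_slot (hT : IsTournament n T) (t : ℕ) {k : ℕ}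
    (hk : ¬ (1 ≤ k ∧ k ≤ 2 * n - 2)) : venue T t k = t := by
  unfold venue
  rw [dif_neg]
  rintro ⟨i, j, h, -⟩
  have := hT.subset _ h
  exact hk ⟨this.1, this.2.1⟩

lemma venue_eq_of_mem (hT : IsTournament n T) {k i j t : ℕ} (h : (k, i, j) ∈ T)
    (ht : t = i ∨ t = j) : venue T t k = i := by
  have hex : ∃ i, ∃ j, (k, i, j) ∈ T ∧ (t = i ∨ t = j) := ⟨i, j, h, ht⟩
  unfold venue
  rw [dif_pos hex]
  obtain ⟨j', h', ht'⟩ := hex.choose_spec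
  obtain ⟨hk, hkn, hi, hin, hj, hjn, -⟩ := hT.subset _ h
  have htr : 1 ≤ t ∧ t ≤ n := by rcases ht with rfl | rfl <;> constructor <;> assumption
  have := (hT.slot_team k hk hkn t htr.1 htr.2).unique ⟨h', rfl, ht'⟩ ⟨h, rfl, ht⟩
  exact congrArg (fun m => m.2.1) this

lemma mem_of_venue_eq {t k v : ℕ} (h : venue T t k = v) (hv : v ≠ t) : (k, v, t) ∈ T := by
  unfold venue at h
  split_ifs at h with hex
  · obtain ⟨j, hj, ht⟩ := hex.choose_spec
    rw [h] at hj ht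
    rcases ht with rfl | rfl
    · exact absurd rfl hv
    · exact hj
  · exact absurd h.symm hv

lemma venue_mem_range (hT : IsTournament n T) {t : ℕ} (ht : 1 ≤ t ∧ t ≤ n) (k : ℕ) :
    1 ≤ venue T t k ∧ venue T t k ≤ n := by
  by_cases hv : venue T t k = t
  · rwa [hv]
  · obtain ⟨-, -, h1, h2, -⟩ := hT.subset _ (mem_of_venue_eq rfl hv)
    exact ⟨h1, h2⟩

lemma slot_of_venue_ne (hT : IsTournament n T) {t k v : ℕ} (h : venue T t k = v) (hv : v ≠ t) :
    1 ≤ k ∧ k ≤ 2 * n - 2 := by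
  obtain ⟨h1, h2, -⟩ := hT.subset _ (mem_of_venue_eq h hv)
  exact ⟨h1, h2⟩

lemma slot_unique_of_venue_ne (hT : IsTournament n T) {t k k' v : ℕ} (h : venue T t k = v)
    (h' : venue T t k' = v) (hv : v ≠ t) : k = k' := by
  have hm := mem_of_venue_eq h hv
  obtain ⟨-, -, h1, h2, h3, h4, h5⟩ := hT.subset _ hm
  exact (hT.pair v t h1 h2 h3 h4 h5).unique hm (mem_of_venue_eq h' hv)

lemma exists_slot_venue_eq (hn : 4 ≤ n) (hT : IsTournament n T) {t v : ℕ} (ht : 1 ≤ t ∧ t ≤ n)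
    (hv : 1 ≤ v ∧ v ≤ n) : ∃ k, (1 ≤ k ∧ k ≤ 2 * n - 2) ∧ venue T t k = v := by
  have key : ∀ i j, 1 ≤ i ∧ i ≤ n → 1 ≤ j ∧ j ≤ n → i ≠ j → (t = i ∨ t = j) →
      ∃ k, (1 ≤ k ∧ k ≤ 2 * n - 2) ∧ venue T t k = i := by
    intro i j hi hj hij htij
    obtain ⟨k, hk, -⟩ := hT.pair i j hi.1 hi.2 hj.1 hj.2 hij
    have := hT.subset _ hk
    exact ⟨k, ⟨this.1, this.2.1⟩, venue_eq_of_mem hT hk htij⟩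
  by_cases hvt : v = t
  · subst hvt
    by_cases h1 : v = 1
    · exact key v 2 hv ⟨by omega, by omega⟩ (by omega) (.inl rfl)
    · exact key v 1 hv ⟨by omega, by omega⟩ h1 (.inl rfl)
  · exact key v t hv ht hvt (.inr rfl)

lemma travel_eq_of_venue (hT : IsTournament n T) {t i k : ℕ} (h : venue T t k = i) (hi : i ≠ t)
    (j : ℕ) : travel n T (t, i, j) = if j = venue T t (k + 1) then 1 else 0 := by
  unfold travel
  congr 1
  refine propext ⟨?_, ?_⟩
  · rintro ⟨k', -, h1, h2⟩
    rw [slot_unique_of_venue_ne hT h h1 hi]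
    exact h2.symm
  · rintro rfl
    exact ⟨k, (slot_of_venue_ne hT h hi).2, h, rfl⟩

lemma travel_eq_of_venue_succ (hT : IsTournament n T) {t i k : ℕ} (h : venue T t (k + 1) = i)
    (hi : i ≠ t) (j : ℕ) : travel n T (t, j, i) = if j = venue T t k then 1 else 0 := by
  unfold travel
  congr 1
  refine propext ⟨?_, ?_⟩
  · rintro ⟨k', -, h1, h2⟩
    have := slot_unique_of_venue_ne hT h h2 hi
    obtain rfl : k = k' := by omega
    exact h1.symm
  · rintro rfl
    have := slot_of_venue_ne hT h hi
    exact ⟨k, by omega, rfl, h⟩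

lemma sum_travel_out (hn : 4 ≤ n) (hT : IsTournament n T) {t i : ℕ} (ht : 1 ≤ t ∧ t ≤ n)
    (hi : 1 ≤ i ∧ i ≤ n) (hit : i ≠ t) : ∑ j ∈ Icc 1 n \ {i}, travel n T (t, i, j) = 1 := by
  obtain ⟨k, -, hk⟩ := exists_slot_venue_eq hn hT ht hi
  have hne : venue T t (k + 1) ≠ i := fun h => by
    have := slot_unique_of_venue_ne hT hk h hit
    omega
  have := venue_mem_range hT ht (k + 1)
  simp [travel_eq_of_venue hT hk hit, this.1, this.2, hne]

lemma sum_travel_in (hn : 4 ≤ n) (hT : IsTournament n T) {t i : ℕ} (ht : 1 ≤ t ∧ t ≤ n)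
    (hi : 1 ≤ i ∧ i ≤ n) (hit : i ≠ t) : ∑ j ∈ Icc 1 n \ {i}, travel n T (t, j, i) = 1 := by
  obtain ⟨k, ⟨hk1, -⟩, hk⟩ := exists_slot_venue_eq hn hT ht hi
  obtain ⟨k, rfl⟩ : ∃ l, k = l + 1 := ⟨k - 1, by omega⟩
  have hne : venue T t k ≠ i := fun h => by
    have := slot_unique_of_venue_ne hT hk h hit
    omega
  have := venue_mem_range hT ht k
  simp [travel_eq_of_venue_succ hT hk hit, this.1, this.2, hne]

end Venue

lemma exists_tournament_venue_three {n : ℕ} (hn : 4 ≤ n) (heven : Even n) {t u v w a b c : ℕ}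
    (ht : 1 ≤ t ∧ t ≤ n) (hu : 1 ≤ u ∧ u ≤ n) (hv : 1 ≤ v ∧ v ≤ n) (hw : 1 ≤ w ∧ w ≤ n)
    (huv : u ≠ v) (huw : u ≠ w) (hvw : v ≠ w)
    (ha : 1 ≤ a ∧ a ≤ 2 * n - 2) (hb : 1 ≤ b ∧ b ≤ 2 * n - 2) (hc : 1 ≤ c ∧ c ≤ 2 * n - 2)
    (hab : a ≠ b) (hac : a ≠ c) (hbc : b ≠ c) :
    ∃ T, IsTournament n T ∧ venue T t a = u ∧ venue T t b = v ∧ venue T t c = w := by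
  have step : ∀ {T : Set (ℕ × ℕ × ℕ)} {x s : ℕ}, IsTournament n T → (1 ≤ x ∧ x ≤ n) →
      (1 ≤ s ∧ s ≤ 2 * n - 2) → ∃ T', IsTournament n T' ∧ venue T' t s = x ∧
        ∀ r, r ≠ s → venue T t r ≠ x → venue T' t r = venue T t r := by
    intro T x s hT hx hs
    obtain ⟨k, hk, hkx⟩ := exists_slot_venue_eq hn hT ht hx
    refine ⟨_, isTournament_permSlots_swap hT hs hk, ?_, fun r hrs hrx => ?_⟩
    · rw [venue_permSlots, Equiv.swap_apply_left, hkx]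
    · rw [venue_permSlots, Equiv.swap_apply_of_ne_of_ne hrs]
      rintro rfl
      exact hrx hkx
  obtain ⟨T₁, hT₁, h₁, -⟩ := step (isTournament_circleTournament heven) hu ha
  obtain ⟨T₂, hT₂, h₂, h₂'⟩ := step hT₁ hv hb
  obtain ⟨T₃, hT₃, h₃, h₃'⟩ := step hT₂ hw hc
  have ha₂ : venue T₂ t a = u := by rw [h₂' a hab (by rwa [h₁]), h₁]
  refine ⟨T₃, hT₃, ?_, ?_, h₃⟩
  · rw [h₃' a hac (by rwa [ha₂]), ha₂]
  · rw [h₃' b hbc (by rwa [h₂]), h₂]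

lemma exists_ne_three {n : ℕ} (hn : 4 ≤ n) (a b c : ℕ) :
    ∃ v, (1 ≤ v ∧ v ≤ n) ∧ a ≠ v ∧ b ≠ v ∧ c ≠ v := by
  by_contra! h
  have h1 := h 1
  have h2 := h 2
  have h3 := h 3
  have h4 := h 4
  omega

lemma exists_travel_eq_zero {n : ℕ} (hn : 4 ≤ n) (heven : Even n) {p : ℕ × ℕ × ℕ}
    (hp : IsTravelIdx n p) : ∃ T, IsTournament n T ∧ travel n T p = 0 := by
  obtain ⟨t, i, j⟩ := p
  obtain ⟨ht, htn, hi, hin, hj, hjn, hij⟩ := hp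
  dsimp only at *
  obtain ⟨v, hv, hiv, hjv, -⟩ := exists_ne_three hn i j j
  by_cases hit : i = t
  · subst hit
    obtain ⟨T, hT, h1, h2, -⟩ := exists_tournament_venue_three (a := 1) (b := 2) (c := 3) hn heven
      ⟨ht, htn⟩ hv ⟨hj, hjn⟩ ⟨hi, hin⟩ hjv.symm hiv.symm hij.symm
      (by omega) (by omega) (by omega) (by omega) (by omega) (by omega)
    refine ⟨T, hT, ?_⟩
    rw [travel_eq_of_venue_succ hT h2 hij.symm, if_neg]
    rwa [h1]
  · obtain ⟨T, hT, h1, h2, -⟩ := exists_tournament_venue_three (a := 1) (b := 2) (c := 3) hn heven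
      ⟨ht, htn⟩ ⟨hi, hin⟩ hv ⟨hj, hjn⟩ hiv hij hjv.symm
      (by omega) (by omega) (by omega) (by omega) (by omega) (by omega)
    refine ⟨T, hT, ?_⟩
    rw [travel_eq_of_venue hT h1 hit, if_neg]
    rwa [h2]

instance finite_match (n : ℕ) : Finite {m : ℕ × ℕ × ℕ // IsMatch n m} :=
  Set.Finite.subset (Set.finite_Icc (0, 0, 0) (2 * n - 2, n, n))
    fun _ ⟨_, h1, _, h2, _, h3, _⟩ => ⟨⟨Nat.zero_le _, Nat.zero_le _, Nat.zero_le _⟩, h1, h2, h3⟩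

instance finite_travelIdx (n : ℕ) : Finite {p : ℕ × ℕ × ℕ // IsTravelIdx n p} :=
  Set.Finite.subset (Set.finite_Icc (0, 0, 0) (n, n, n))
    fun _ ⟨_, h1, _, h2, _, h3, _⟩ => ⟨⟨Nat.zero_le _, Nat.zero_le _, Nat.zero_le _⟩, h1, h2, h3⟩

noncomputable instance fintype_travelIdx (n : ℕ) : Fintype {p : ℕ × ℕ × ℕ // IsTravelIdx n p} :=
  Fintype.ofFinite _

/-- The point `(χ(T), ψ(T))`. -/
noncomputable def tourPt (n : ℕ) (T : Set (ℕ × ℕ × ℕ)) : Pt n :=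
  (fun m => play T m.1, fun p => travel n T p.1)

/-- The unit vector of a travel coordinate. -/
noncomputable def travelUnit (n : ℕ) (p : {p : ℕ × ℕ × ℕ // IsTravelIdx n p}) : Pt n :=
  (0, Pi.single p 1)

/-- The points `(χ(T), y)` spanning `Ptt(n)`. -/
def generators (n : ℕ) : Set (Pt n) :=
  { z : Pt n | ∃ T : Set (ℕ × ℕ × ℕ), IsTournament n T ∧
    (∀ m : {m : ℕ × ℕ × ℕ // IsMatch n m}, z.1 m = play T m.1) ∧
    (∀ p : {p : ℕ × ℕ × ℕ // IsTravelIdx n p}, z.2 p = 0 ∨ z.2 p = 1) ∧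
    (∀ p : {p : ℕ × ℕ × ℕ // IsTravelIdx n p}, travel n T p.1 ≤ z.2 p) }

lemma Ptt_eq_convexHull (n : ℕ) : Ptt n = convexHull ℝ (generators n) := rfl

lemma generators_subset_Ptt (n : ℕ) : generators n ⊆ Ptt n := subset_convexHull ℝ _

lemma travel_eq_zero_or_one (n : ℕ) (T : Set (ℕ × ℕ × ℕ)) (p : ℕ × ℕ × ℕ) :
    travel n T p = 0 ∨ travel n T p = 1 := by
  unfold travel
  split_ifs <;> simp

section Generators

variable {n : ℕ} {T : Set (ℕ × ℕ × ℕ)}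

lemma tourPt_mem_generators (hT : IsTournament n T) : tourPt n T ∈ generators n :=
  ⟨T, hT, fun _ => rfl, fun p => travel_eq_zero_or_one n T p.1, fun _ => le_rfl⟩

lemma tourPt_add_travelUnit_mem_generators (hT : IsTournament n T)
    {p : {p : ℕ × ℕ × ℕ // IsTravelIdx n p}} (hp : travel n T p.1 = 0) :
    tourPt n T + travelUnit n p ∈ generators n := by
  refine ⟨T, hT, fun m => by simp [tourPt, travelUnit], fun q => ?_, fun q => ?_⟩
  · by_cases h : q = p
    · subst h
      simp [tourPt, travelUnit, hp]
    · simpa [tourPt, travelUnit, h] using travel_eq_zero_or_one n T q.1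
  · by_cases h : q = p
    · subst h
      simp [tourPt, travelUnit]
    · simp [tourPt, travelUnit, h]

lemma snd_eq_sum_travelUnit (y : {p : ℕ × ℕ × ℕ // IsTravelIdx n p} → ℝ) :
    ((0, y) : Pt n) = ∑ p, y p • travelUnit n p := by
  refine Prod.ext ?_ ?_
  · simp [travelUnit, Prod.fst_sum]
  · ext q
    simp [travelUnit, Prod.snd_sum, Finset.sum_apply, Pi.single_apply]

lemma eq_tourPt_add {z : Pt n} (hz : ∀ m : {m : ℕ × ℕ × ℕ // IsMatch n m}, z.1 m = play T m.1) :
    z = tourPt n T + (0, fun p => z.2 p - travel n T p.1) := by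
  refine Prod.ext ?_ ?_
  · ext m
    simp [tourPt, hz]
  · ext p
    simp [tourPt]

end Generators

/-- A sum of travel coordinates over `S` that equals `1` at every tournament defines a facet as
soon as any two unit vectors of `S` differ, modulo coordinates outside `S`, by an alternating sum
of four tournaments. -/
theorem isFacetGE_of_travel_sum {n : ℕ} (hn : 4 ≤ n) (heven : Even n) (f : Pt n →ₗ[ℝ] ℝ)
    (S : Set (ℕ × ℕ × ℕ))
    (hunit : ∀ p : {p : ℕ × ℕ × ℕ // IsTravelIdx n p},
      f (travelUnit n p) = if p.1 ∈ S then 1 else 0)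
    (htour : ∀ T, IsTournament n T → f (tourPt n T) = 1)
    (hne : ∃ p ∈ S, IsTravelIdx n p)
    (hswap : ∀ p ∈ S, ∀ q ∈ S, IsTravelIdx n p → IsTravelIdx n q → p ≠ q →
      ∃ T₁ T₂ T₃ T₄, IsTournament n T₁ ∧ IsTournament n T₂ ∧ IsTournament n T₃ ∧
        IsTournament n T₄ ∧ (∀ m, play T₁ m + play T₄ m = play T₂ m + play T₃ m) ∧
        ∀ s ∈ S, travel n T₁ s + travel n T₄ s - (travel n T₂ s + travel n T₃ s) =
          (if s = p then 1 else 0) - (if s = q then 1 else 0)) :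
    IsFacetGE (fun z => f z) 1 := by
  have hvalid : ∀ z ∈ Ptt n, 1 ≤ f z := by
    have hconv : Convex ℝ {z : Pt n | 1 ≤ f z} := convex_halfSpace_ge f.isLinear 1
    refine convexHull_min ?_ hconv
    rintro z ⟨T, hT, hz, -, hle⟩
    show 1 ≤ f z
    rw [eq_tourPt_add hz, map_add, htour T hT, snd_eq_sum_travelUnit, map_sum]
    refine le_add_of_nonneg_right (Finset.sum_nonneg fun p _ => ?_)
    rw [map_smul, hunit, smul_eq_mul]
    exact mul_nonneg (sub_nonneg.2 (hle p)) (by split_ifs <;> norm_num)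
  refine ⟨hvalid, ?_⟩
  set L := (affineSpan ℝ {z ∈ Ptt n | f z = 1}).direction with hL
  set D := (affineSpan ℝ (Ptt n)).direction with hD
  show Module.finrank ℝ L + 1 = Module.finrank ℝ D
  have subL : ∀ {z w : Pt n}, z ∈ generators n → f z = 1 → w ∈ generators n → f w = 1 →
      z - w ∈ L := fun hz hfz hw hfw =>
    AffineSubspace.vsub_mem_direction
      (subset_affineSpan ℝ _ ⟨generators_subset_Ptt n hz, hfz⟩)
      (subset_affineSpan ℝ _ ⟨generators_subset_Ptt n hw, hfw⟩)
  have tourL : ∀ {T T'}, IsTournament n T → IsTournament n T' →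
      tourPt n T - tourPt n T' ∈ L := fun h h' =>
    subL (tourPt_mem_generators h) (htour _ h) (tourPt_mem_generators h') (htour _ h')
  have unitL : ∀ p : {p : ℕ × ℕ × ℕ // IsTravelIdx n p}, p.1 ∉ S → travelUnit n p ∈ L := by
    intro p hp
    obtain ⟨T, hT, h0⟩ := exists_travel_eq_zero hn heven p.2
    have := subL (tourPt_add_travelUnit_mem_generators hT h0)
      (by rw [map_add, htour T hT, hunit, if_neg hp, add_zero])
      (tourPt_mem_generators hT) (htour T hT)
    rwa [add_sub_cancel_left] at this
  have diffL : ∀ p q : {p : ℕ × ℕ × ℕ // IsTravelIdx n p}, p.1 ∈ S → q.1 ∈ S →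
      travelUnit n p - travelUnit n q ∈ L := by
    intro p q hp hq
    by_cases hpq : p = q
    · rw [hpq, sub_self]
      exact L.zero_mem
    obtain ⟨T₁, T₂, T₃, T₄, h₁, h₂, h₃, h₄, hplay, htravel⟩ :=
      hswap p.1 hp q.1 hq p.2 q.2 (fun h => hpq (Subtype.ext h))
    have hsum := L.add_mem (tourL h₁ h₂) (tourL h₄ h₃)
    set y : {p : ℕ × ℕ × ℕ // IsTravelIdx n p} → ℝ := fun s =>
      travel n T₁ s.1 + travel n T₄ s.1 - (travel n T₂ s.1 + travel n T₃ s.1) -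
        ((if s.1 = p.1 then 1 else 0) - (if s.1 = q.1 then 1 else 0)) with hy
    have hyL : ((0, y) : Pt n) ∈ L := by
      rw [snd_eq_sum_travelUnit]
      refine L.sum_mem fun s _ => ?_
      by_cases hs : s.1 ∈ S
      · rw [hy]
        simp only [htravel s.1 hs, sub_self, zero_smul, L.zero_mem]
      · exact L.smul_mem _ (unitL s hs)
    have := L.sub_mem hsum hyL
    convert this using 1
    refine Prod.ext ?_ ?_
    · ext m
      have := hplay m.1
      simp only [tourPt, travelUnit, Prod.fst_sub, Prod.fst_add, Pi.sub_apply, Pi.add_apply,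
        Pi.zero_apply]
      linarith
    · ext s
      simp only [tourPt, travelUnit, Prod.snd_sub, Prod.snd_add, Pi.sub_apply, Pi.add_apply,
        Pi.single_apply, hy, Subtype.ext_iff]
      ring
  obtain ⟨p₀, hp₀, hidx⟩ := hne
  set u := travelUnit n ⟨p₀, hidx⟩ with hu
  have hfu : f u = 1 := by rw [hunit, if_pos hp₀]
  have hLD : L ≤ D := AffineSubspace.direction_le (affineSpan_mono ℝ (Set.sep_subset _ _))
  have huD : u ∈ D := by
    obtain ⟨T, hT, h0⟩ := exists_travel_eq_zero hn heven hidx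
    have := AffineSubspace.vsub_mem_direction
      (subset_affineSpan ℝ _ (generators_subset_Ptt n
        (tourPt_add_travelUnit_mem_generators (p := ⟨p₀, hidx⟩) hT h0)))
      (subset_affineSpan ℝ _ (generators_subset_Ptt n (tourPt_mem_generators hT)))
    rwa [vsub_eq_sub, add_sub_cancel_left] at this
  have hLker : L ≤ LinearMap.ker f := by
    rw [hL, direction_affineSpan, vectorSpan_def, Submodule.span_le]
    rintro _ ⟨z, hz, w, hw, rfl⟩
    simp [hz.2, hw.2]
  have huL : u ∉ L := fun h => one_ne_zero (hfu.symm.trans (hLker h))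
  have hlt : L < D := lt_of_le_of_ne hLD fun h => huL (h ▸ huD)
  have sndM : ∀ y : {p : ℕ × ℕ × ℕ // IsTravelIdx n p} → ℝ,
      ((0, y) : Pt n) ∈ L ⊔ Submodule.span ℝ {u} := by
    intro y
    rw [snd_eq_sum_travelUnit]
    refine Submodule.sum_mem _ fun p _ => Submodule.smul_mem _ _ ?_
    by_cases hp : p.1 ∈ S
    · rw [← sub_add_cancel (travelUnit n p) u]
      exact Submodule.add_mem_sup (diffL p ⟨p₀, hidx⟩ hp hp₀) (Submodule.mem_span_singleton_self u)
    · exact Submodule.mem_sup_left (unitL p hp)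
  have hDM : D ≤ L ⊔ Submodule.span ℝ {u} := by
    rw [hD, Ptt_eq_convexHull, affineSpan_convexHull, direction_affineSpan, vectorSpan_def,
      Submodule.span_le]
    rintro _ ⟨z, ⟨T, hT, hz, -⟩, w, ⟨T', hT', hw, -⟩, rfl⟩
    dsimp only
    rw [eq_tourPt_add hz, eq_tourPt_add hw, vsub_eq_sub, add_sub_add_comm]
    exact Submodule.add_mem _ (Submodule.mem_sup_left (tourL hT hT'))
      (Submodule.sub_mem _ (sndM _) (sndM _))
  have hle : Module.finrank ℝ D ≤ Module.finrank ℝ L + 1 :=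
    (Submodule.finrank_mono hDM).trans <|
      (Submodule.finrank_add_le_finrank_add_finrank L _).trans <|
        Nat.add_le_add_left (finrank_span_singleton (K := ℝ) fun h : u = 0 => by
          simp [h] at hfu).le _
  exact le_antisymm (Submodule.finrank_lt_finrank_of_lt hlt) hle

lemma play_permSlots (σ : Equiv.Perm ℕ) (T : Set (ℕ × ℕ × ℕ)) (k i j : ℕ) :
    play (permSlots σ T) (k, i, j) = play T (σ k, i, j) := rfl

lemma play_permSlots_swap (T : Set (ℕ × ℕ × ℕ)) {a b c d : ℕ} (hac : a ≠ c) (had : a ≠ d)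
    (hbc : b ≠ c) (hbd : b ≠ d) (m : ℕ × ℕ × ℕ) :
    play T m + play (permSlots (Equiv.swap c d) (permSlots (Equiv.swap a b) T)) m =
      play (permSlots (Equiv.swap c d) T) m + play (permSlots (Equiv.swap a b) T) m := by
  obtain ⟨k, i, j⟩ := m
  simp only [play_permSlots]
  by_cases hk : k = a ∨ k = b
  · have hkc : k ≠ c := by rcases hk with rfl | rfl <;> assumption
    have hkd : k ≠ d := by rcases hk with rfl | rfl <;> assumption
    rw [Equiv.swap_apply_of_ne_of_ne hkc hkd]
  · push Not at hk
    have hs : Equiv.swap a b (Equiv.swap c d k) = Equiv.swap c d k := by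
      rw [Equiv.swap_apply_def c d k]
      split_ifs
      · exact Equiv.swap_apply_of_ne_of_ne had.symm hbd.symm
      · exact Equiv.swap_apply_of_ne_of_ne hac.symm hbc.symm
      · exact Equiv.swap_apply_of_ne_of_ne hk.1 hk.2
    rw [hs, Equiv.swap_apply_of_ne_of_ne hk.1 hk.2, add_comm]

/-- The sum of the travel coordinates indexed by `g j` for `j ∈ V ∖ {i}`, as a linear map. -/
noncomputable def travelSum (n i : ℕ) (g : ℕ → ℕ × ℕ × ℕ) : Pt n →ₗ[ℝ] ℝ where
  toFun z := ∑ j ∈ Icc 1 n \ {i}, yval z (g j).1 (g j).2.1 (g j).2.2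
  map_add' z w := by
    rw [← Finset.sum_add_distrib]
    refine Finset.sum_congr rfl fun j _ => ?_
    unfold yval
    split_ifs <;> simp
  map_smul' r z := by
    rw [RingHom.id_apply, smul_eq_mul, Finset.mul_sum]
    refine Finset.sum_congr rfl fun j _ => ?_
    unfold yval
    split_ifs <;> simp

lemma travelSum_travelUnit {n i : ℕ} {g : ℕ → ℕ × ℕ × ℕ} (hg : g.Injective)
    (hidx : ∀ j, IsTravelIdx n (g j) ↔ j ∈ Icc 1 n \ {i})
    (p : {p : ℕ × ℕ × ℕ // IsTravelIdx n p}) :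
    travelSum n i g (travelUnit n p) = if p.1 ∈ Set.range g then 1 else 0 := by
  have hterm : ∀ j ∈ Icc 1 n \ {i},
      yval (travelUnit n p) (g j).1 (g j).2.1 (g j).2.2 = if g j = p.1 then 1 else 0 := by
    intro j hj
    have h := (hidx j).2 hj
    unfold yval
    rw [dif_pos h]
    simp [travelUnit, Pi.single_apply, Subtype.ext_iff]
  refine (Finset.sum_congr rfl hterm).trans ?_
  split_ifs with h
  · obtain ⟨j, hj⟩ := h
    have hmem : j ∈ Icc 1 n \ {i} := (hidx j).1 (hj ▸ p.2)
    simp only [← hj, hg.eq_iff]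
    rw [Finset.sum_ite_eq', if_pos hmem]
  · exact Finset.sum_eq_zero fun j _ => if_neg fun hj => h ⟨j, hj⟩

lemma travelSum_tourPt {n i : ℕ} {g : ℕ → ℕ × ℕ × ℕ}
    (hidx : ∀ j, IsTravelIdx n (g j) ↔ j ∈ Icc 1 n \ {i}) (T : Set (ℕ × ℕ × ℕ)) :
    travelSum n i g (tourPt n T) = ∑ j ∈ Icc 1 n \ {i}, travel n T (g j) := by
  rw [travelSum, LinearMap.coe_mk, AddHom.coe_mk]
  refine Finset.sum_congr rfl fun j hj => ?_
  unfold yval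
  rw [dif_pos ((hidx j).2 hj)]
  rfl

theorem isFacetGE_flow_out {n : ℕ} (hn : 4 ≤ n) (heven : Even n) {i t : ℕ} (hi : 1 ≤ i ∧ i ≤ n)
    (ht : 1 ≤ t ∧ t ≤ n) (hit : i ≠ t) :
    IsFacetGE (fun z : Pt n => ∑ j ∈ Icc 1 n \ {i}, yval z t i j) 1 := by
  have hidx : ∀ j, IsTravelIdx n (t, i, j) ↔ j ∈ Icc 1 n \ {i} := by
    intro j
    simp only [IsTravelIdx, mem_sdiff, mem_Icc, mem_singleton]
    omega
  refine isFacetGE_of_travel_sum hn heven (travelSum n i fun j => (t, i, j))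
    (Set.range fun j => (t, i, j)) (travelSum_travelUnit (fun a b h => by simpa using h) hidx)
    (fun T hT => (travelSum_tourPt hidx T).trans (sum_travel_out hn hT ht hi hit))
    ⟨_, ⟨t, rfl⟩, (hidx t).2 (by simp [ht.1, ht.2, hit.symm])⟩ ?_
  rintro _ ⟨j, rfl⟩ _ ⟨j', rfl⟩ hp hq hpq
  obtain ⟨-, -, -, -, hj, hjn, hij⟩ := hp
  obtain ⟨-, -, -, -, hj', hjn', hij'⟩ := hq
  have hjj : j ≠ j' := fun h => hpq (by rw [h])
  dsimp only at hj hjn hij hj' hjn' hij'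
  obtain ⟨T, hT, h1, h2, h3⟩ := exists_tournament_venue_three (a := 1) (b := 2) (c := 3) hn heven
    ht hi ⟨hj, hjn⟩ ⟨hj', hjn'⟩ hij hij' hjj
    (by omega) (by omega) (by omega) (by omega) (by omega) (by omega)
  have hTa : IsTournament n (permSlots (Equiv.swap 1 (2 * n - 2)) T) :=
    isTournament_permSlots_swap hT (by omega) (by omega)
  have hTc : IsTournament n (permSlots (Equiv.swap 2 3) T) :=
    isTournament_permSlots_swap hT (by omega) (by omega)
  have hTac : IsTournament n
      (permSlots (Equiv.swap 2 3) (permSlots (Equiv.swap 1 (2 * n - 2)) T)) :=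
    isTournament_permSlots_swap hTa (by omega) (by omega)
  have hs23 : Equiv.swap 2 3 (2 * n - 2) = 2 * n - 2 :=
    Equiv.swap_apply_of_ne_of_ne (by omega) (by omega)
  refine ⟨T, _, _, _, hT, hTc, hTa, hTac, play_permSlots_swap T (by omega) (by omega) (by omega)
    (by omega), ?_⟩
  rintro _ ⟨s, rfl⟩
  have hv1 : venue (permSlots (Equiv.swap 2 3) T) t 1 = i := by
    rwa [venue_permSlots, Equiv.swap_apply_of_ne_of_ne (by omega) (by omega)]
  have hva : venue (permSlots (Equiv.swap 1 (2 * n - 2)) T) t (2 * n - 2) = i := by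
    rwa [venue_permSlots, Equiv.swap_apply_right]
  have hvac : venue (permSlots (Equiv.swap 2 3) (permSlots (Equiv.swap 1 (2 * n - 2)) T)) t
      (2 * n - 2) = i := by
    rwa [venue_permSlots, hs23]
  have hv2 : venue (permSlots (Equiv.swap 2 3) T) t (1 + 1) = j' := by
    rwa [venue_permSlots, Equiv.swap_apply_left]
  simp only [travel_eq_of_venue hT h1 hit, travel_eq_of_venue hTc hv1 hit,
    travel_eq_of_venue hTa hva hit, travel_eq_of_venue hTac hvac hit,
    venue_eq_self_of_not_slot hTa t (k := 2 * n - 2 + 1) (by omega),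
    venue_eq_self_of_not_slot hTac t (k := 2 * n - 2 + 1) (by omega), hv2, h2, Prod.mk.injEq,
    true_and]
  ring

theorem isFacetGE_flow_in {n : ℕ} (hn : 4 ≤ n) (heven : Even n) {i t : ℕ} (hi : 1 ≤ i ∧ i ≤ n)
    (ht : 1 ≤ t ∧ t ≤ n) (hit : i ≠ t) :
    IsFacetGE (fun z : Pt n => ∑ j ∈ Icc 1 n \ {i}, yval z t j i) 1 := by
  have hidx : ∀ j, IsTravelIdx n (t, j, i) ↔ j ∈ Icc 1 n \ {i} := by
    intro j
    simp only [IsTravelIdx, mem_sdiff, mem_Icc, mem_singleton]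
    omega
  refine isFacetGE_of_travel_sum hn heven (travelSum n i fun j => (t, j, i))
    (Set.range fun j => (t, j, i)) (travelSum_travelUnit (fun a b h => by simpa using h) hidx)
    (fun T hT => (travelSum_tourPt hidx T).trans (sum_travel_in hn hT ht hi hit))
    ⟨_, ⟨t, rfl⟩, (hidx t).2 (by simp [ht.1, ht.2, hit.symm])⟩ ?_
  rintro _ ⟨j, rfl⟩ _ ⟨j', rfl⟩ hp hq hpq
  obtain ⟨-, -, hj, hjn, -, -, hij⟩ := hp
  obtain ⟨-, -, hj', hjn', -, -, hij'⟩ := hq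
  have hjj : j ≠ j' := fun h => hpq (by rw [h])
  dsimp only at hj hjn hij hj' hjn' hij'
  obtain ⟨T, hT, h4, h3, h2⟩ := exists_tournament_venue_three (a := 4) (b := 3) (c := 2) hn heven
    ht hi ⟨hj, hjn⟩ ⟨hj', hjn'⟩ hij.symm hij'.symm hjj
    (by omega) (by omega) (by omega) (by omega) (by omega) (by omega)
  have hTa : IsTournament n (permSlots (Equiv.swap 1 4) T) :=
    isTournament_permSlots_swap hT (by omega) (by omega)
  have hTc : IsTournament n (permSlots (Equiv.swap 2 3) T) :=
    isTournament_permSlots_swap hT (by omega) (by omega)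
  have hTac : IsTournament n (permSlots (Equiv.swap 2 3) (permSlots (Equiv.swap 1 4) T)) :=
    isTournament_permSlots_swap hTa (by omega) (by omega)
  refine ⟨T, _, _, _, hT, hTc, hTa, hTac, play_permSlots_swap T (by omega) (by omega) (by omega)
    (by omega), ?_⟩
  rintro _ ⟨s, rfl⟩
  have hv4 : venue (permSlots (Equiv.swap 2 3) T) t (3 + 1) = i := by
    rwa [venue_permSlots, Equiv.swap_apply_of_ne_of_ne (by omega) (by omega)]
  have hva : venue (permSlots (Equiv.swap 1 4) T) t (0 + 1) = i := by
    rwa [venue_permSlots, Equiv.swap_apply_left]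
  have hvac : venue (permSlots (Equiv.swap 2 3) (permSlots (Equiv.swap 1 4) T)) t (0 + 1) = i := by
    rwa [venue_permSlots, Equiv.swap_apply_of_ne_of_ne (by omega) (by omega)]
  have hv3 : venue (permSlots (Equiv.swap 2 3) T) t 3 = j' := by
    rwa [venue_permSlots, Equiv.swap_apply_right]
  simp only [travel_eq_of_venue_succ hT h4 hit, travel_eq_of_venue_succ hTc hv4 hit,
    travel_eq_of_venue_succ hTa hva hit, travel_eq_of_venue_succ hTac hvac hit,
    venue_eq_self_of_not_slot hTa t (k := 0) (by omega),
    venue_eq_self_of_not_slot hTac t (k := 0) (by omega), hv3, h3, Prod.mk.injEq,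
    true_and, and_true]
  ring

/-- the flow inequalities are facet-defining. -/
theorem flow_facet (n : ℕ) (hn : 4 ≤ n) (heven : Even n)
    (i t : ℕ) (hi1 : 1 ≤ i) (hin : i ≤ n) (ht1 : 1 ≤ t) (htn : t ≤ n) (hit : i ≠ t) :
    IsFacetGE (fun z : Pt n => ∑ j ∈ Finset.Icc 1 n \ {i}, yval z t i j) 1 ∧
    IsFacetGE (fun z : Pt n => ∑ j ∈ Finset.Icc 1 n \ {i}, yval z t j i) 1 := by
  exact ⟨isFacetGE_flow_out hn heven ⟨hi1, hin⟩ ⟨ht1, htn⟩ hit,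
    isFacetGE_flow_in hn heven ⟨hi1, hin⟩ ⟨ht1, htn⟩ hit⟩

end TTP
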